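/- Let s > 1/2 and let δ₀ ∈ 𝒮'(ℝ^d) be the Dirac distribution at the origin, δ₀(φ) = φ(0). Then for any window φ ∈ Σ_s(ℝ^d) \ {0}, WF^s(δ₀) = {0} × (ℝ^d \ {0}); that is, a point (x₀,ξ₀) ∈ ℝ^{2d} \ {0} belongs to WF^s(δ₀) if and only if x₀ = 0 and ξ₀ ≠ 0. -/

import Mathlib

open MeasureTheory Filter
open scoped BigOperators ENNReal RealInnerProductSpace

noncomputable section

/-- `ℝ^d` with the Euclidean norm. -/
abbrev Ed (d : ℕ) : Type := EuclideanSpace ℝ (Fin d)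

/-- Partial derivative along the `i`-th coordinate direction. -/
def pdGS {d : ℕ} (i : Fin d) (f : Ed d → ℂ) : Ed d → ℂ :=
  fun x => fderiv ℝ f x (EuclideanSpace.single i 1)

/-- Multi-index partial derivative `∂^β`. -/
def mderiv {d : ℕ} (β : Fin d → ℕ) (f : Ed d → ℂ) : Ed d → ℂ :=
  ((List.ofFn fun i : Fin d => (pdGS i)^[β i]).foldr (· ∘ ·) id) f

/-- Monomial `x^α`. -/
def mpow {d : ℕ} (x : Ed d) (α : Fin d → ℕ) : ℝ := ∏ i, x i ^ α i

/-- Multi-index factorial `α!`. -/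
def mfact {d : ℕ} (α : Fin d → ℕ) : ℕ := ∏ i, Nat.factorial (α i)

/-- Multi-index length `|α|`. -/
def mlen {d : ℕ} (α : Fin d → ℕ) : ℕ := ∑ i, α i

/-- The Gelfand–Shilov seminorm `‖f‖_{S_{s,h}}`, valued in `[0,∞]`. -/
def GSnorm {d : ℕ} (s h : ℝ) (f : Ed d → ℂ) : ℝ≥0∞ :=
  ⨆ (x : Ed d) (α : Fin d → ℕ) (β : Fin d → ℕ),
    ENNReal.ofReal (|mpow x α| * ‖mderiv β f x‖ /
      (h ^ (mlen α + mlen β) * ((mfact α : ℝ) * (mfact β : ℝ)) ^ s))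

/-- The Gelfand–Shilov space `Σ_s(ℝ^d)`: smooth functions all of whose
`S_{s,h}` seminorms are finite. -/
def SigmaGS (s : ℝ) (d : ℕ) : Set (Ed d → ℂ) :=
  {f | ContDiff ℝ ((⊤ : ℕ∞) : WithTop ℕ∞) f ∧ ∀ h : ℝ, 0 < h → GSnorm s h f < ⊤}

/-- The seminorm `|f|_A`, valued in `[0,∞]`. -/
def GSnormA {d : ℕ} (s A : ℝ) (f : Ed d → ℂ) : ℝ≥0∞ :=
  ⨆ (x : Ed d) (β : Fin d → ℕ),
    ENNReal.ofReal (A ^ mlen β * Real.exp (A * ‖x‖ ^ (1/s)) * ‖mderiv β f x‖ /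
      (mfact β : ℝ) ^ s)

/-- The Fourier transform `f̂(ξ) = ∫ f(x) e^{-i⟨x,ξ⟩} dx`. -/
def FTgs {d : ℕ} (f : Ed d → ℂ) (ξ : Ed d) : ℂ :=
  ∫ x : Ed d, f x * Complex.exp (-(Complex.I * (⟪x, ξ⟫ : ℝ)))

/-- The short-time Fourier transform of a function `f` with window `φ`. -/
def STFTgs {d : ℕ} (φ f : Ed d → ℂ) (z : Ed d × Ed d) : ℂ :=
  ∫ y : Ed d, f y * (starRingEnd ℂ) (φ (y - z.1)) * Complex.exp (-(Complex.I * (⟪y, z.2⟫ : ℝ)))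

/-- Euclidean norm of a phase-space point `(x,ξ) ∈ ℝ^{2d}`. -/
def pnorm {d : ℕ} (z : Ed d × Ed d) : ℝ := Real.sqrt (‖z.1‖ ^ 2 + ‖z.2‖ ^ 2)

/-- A conic subset: invariant under multiplication by positive reals. -/
def IsConic {V : Type*} [SMul ℝ V] (Γ : Set V) : Prop :=
  ∀ t : ℝ, 0 < t → ∀ z ∈ Γ, t • z ∈ Γ

/-- Tempered distributions on `ℝ^d`. -/
abbrev TD (d : ℕ) : Type := SchwartzMap (Ed d) ℂ →L[ℂ] ℂ

/-- `W` is the short-time Fourier transform `V_φ u` of the tempered distribution `u`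
with respect to the window `φ`. -/
def IsSTFT {d : ℕ} (u : TD d) (φ : Ed d → ℂ) (W : Ed d × Ed d → ℂ) : Prop :=
  ∀ (x ξ : Ed d) (g : SchwartzMap (Ed d) ℂ),
    (∀ y : Ed d, g y = (starRingEnd ℂ) (φ (y - x)) * Complex.exp (-(Complex.I * (⟪y, ξ⟫ : ℝ)))) →
    W (x, ξ) = u g

/-- The `s`-Gelfand–Shilov wave front set of a distribution whose short-time Fourier
transform is `W`: the set of nonzero phase-space points having no open conic
neighbourhood on which `e^{A|z|^{1/s}} |W(z)|` is bounded for every `A > 0`. -/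
def WFs {d : ℕ} (s : ℝ) (W : Ed d × Ed d → ℂ) : Set (Ed d × Ed d) :=
  {z₀ | z₀ ≠ 0 ∧ ¬ ∃ Γ : Set (Ed d × Ed d), IsOpen Γ ∧ IsConic Γ ∧
    (0 : Ed d × Ed d) ∉ Γ ∧ z₀ ∈ Γ ∧
    ∀ A : ℝ, 0 < A → ∃ C : ℝ, ∀ z ∈ Γ, Real.exp (A * pnorm z ^ (1/s)) * ‖W z‖ ≤ C}

/-- The real quadratic form `⟨Bx, x⟩` of a matrix `B`. -/
def qf {d : ℕ} (B : Matrix (Fin d) (Fin d) ℝ) (x : Ed d) : ℝ :=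
  ∑ i, (∑ j, B i j * x j) * x i

/-- Tempered distributions on `ℝ^m × ℝ^n`. -/
abbrev TD2 (m n : ℕ) : Type := SchwartzMap (Ed m × Ed n) ℂ →L[ℂ] ℂ

/-- Short-time Fourier transform of a tempered distribution on `ℝ^m × ℝ^n`. -/
def IsSTFT2 {m n : ℕ} (w : TD2 m n) (Φ : Ed m × Ed n → ℂ)
    (W : (Ed m × Ed n) × (Ed m × Ed n) → ℂ) : Prop :=
  ∀ (x ξ : Ed m × Ed n) (g : SchwartzMap (Ed m × Ed n) ℂ),
    (∀ y : Ed m × Ed n, g y = (starRingEnd ℂ) (Φ (y - x)) *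
      Complex.exp (-(Complex.I * ((⟪y.1, ξ.1⟫ + ⟪y.2, ξ.2⟫ : ℝ))))) →
    W (x, ξ) = w g

/-- Euclidean norm of a phase-space point of `T^*(ℝ^m × ℝ^n)`. -/
def pnorm2 {m n : ℕ} (z : (Ed m × Ed n) × (Ed m × Ed n)) : ℝ :=
  Real.sqrt (‖z.1.1‖ ^ 2 + ‖z.1.2‖ ^ 2 + ‖z.2.1‖ ^ 2 + ‖z.2.2‖ ^ 2)

/-- The `s`-Gelfand–Shilov wave front set on `ℝ^m × ℝ^n`. -/
def WFs2 {m n : ℕ} (s : ℝ) (W : (Ed m × Ed n) × (Ed m × Ed n) → ℂ) :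
    Set ((Ed m × Ed n) × (Ed m × Ed n)) :=
  {z₀ | z₀ ≠ 0 ∧ ¬ ∃ Γ : Set ((Ed m × Ed n) × (Ed m × Ed n)), IsOpen Γ ∧ IsConic Γ ∧
    (0 : (Ed m × Ed n) × (Ed m × Ed n)) ∉ Γ ∧ z₀ ∈ Γ ∧
    ∀ A : ℝ, 0 < A → ∃ C : ℝ, ∀ z ∈ Γ, Real.exp (A * pnorm2 z ^ (1/s)) * ‖W z‖ ≤ C}

lemma pdGS_contDiff {d : ℕ} (i : Fin d) {f : Ed d → ℂ}
    (hf : ContDiff ℝ ((⊤ : ℕ∞) : WithTop ℕ∞) f) :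
    ContDiff ℝ ((⊤ : ℕ∞) : WithTop ℕ∞) (pdGS i f) :=
  (hf.fderiv_right (m := ((⊤ : ℕ∞) : WithTop ℕ∞)) (by simp)).clm_apply contDiff_const

lemma pdGS_comm {d : ℕ} (i j : Fin d) {f : Ed d → ℂ}
    (hf : ContDiff ℝ ((⊤ : ℕ∞) : WithTop ℕ∞) f) :
    pdGS i (pdGS j f) = pdGS j (pdGS i f) := by
  have hd : Differentiable ℝ (fderiv ℝ f) :=
    (hf.fderiv_right (m := ((⊤ : ℕ∞) : WithTop ℕ∞)) (by simp)).differentiable (by simp)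
  have key (k l : Fin d) (x : Ed d) : pdGS k (pdGS l f) x =
      fderiv ℝ (fderiv ℝ f) x (EuclideanSpace.single k 1) (EuclideanSpace.single l 1) := by
    unfold pdGS
    rw [fderiv_clm_apply (hd x) (differentiableAt_const _)]
    simp
  funext x
  rw [key, key]
  exact (hf.contDiffAt (x := x)).isSymmSndFDerivAt
    (by simpa using WithTop.coe_le_coe.2 (le_top : (2 : ℕ∞) ≤ ⊤)) _ _

lemma pdGS_iterate_contDiff {d : ℕ} (j : Fin d) (n : ℕ) {f : Ed d → ℂ}
    (hf : ContDiff ℝ ((⊤ : ℕ∞) : WithTop ℕ∞) f) :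
    ContDiff ℝ ((⊤ : ℕ∞) : WithTop ℕ∞) ((pdGS j)^[n] f) := by
  induction n with
  | zero => exact hf
  | succ n ih => rw [Function.iterate_succ_apply']; exact pdGS_contDiff j ih

lemma pdGS_iterate_comm {d : ℕ} (i j : Fin d) (n : ℕ) {f : Ed d → ℂ}
    (hf : ContDiff ℝ ((⊤ : ℕ∞) : WithTop ℕ∞) f) :
    (pdGS j)^[n] (pdGS i f) = pdGS i ((pdGS j)^[n] f) := by
  induction n with
  | zero => rfl
  | succ n ih =>
    rw [Function.iterate_succ_apply', Function.iterate_succ_apply', ih,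
      pdGS_comm i j (pdGS_iterate_contDiff j n hf)]

/-- The partial derivatives `∂_j^{β_j}`, for `j` running through the list `l`, composed in order. -/
def listDeriv {d : ℕ} (l : List (Fin d)) (β : Fin d → ℕ) (f : Ed d → ℂ) : Ed d → ℂ :=
  ((l.map fun i : Fin d => (pdGS i)^[β i]).foldr (· ∘ ·) id) f

lemma listDeriv_cons {d : ℕ} (j : Fin d) (l : List (Fin d)) (β : Fin d → ℕ) (f : Ed d → ℂ) :
    listDeriv (j :: l) β f = (pdGS j)^[β j] (listDeriv l β f) := rfl

lemma mderiv_eq_listDeriv {d : ℕ} (β : Fin d → ℕ) (f : Ed d → ℂ) :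
    mderiv β f = listDeriv (List.finRange d) β f := by
  simp [mderiv, listDeriv, List.ofFn_eq_map]

lemma listDeriv_contDiff {d : ℕ} (l : List (Fin d)) (β : Fin d → ℕ) {f : Ed d → ℂ}
    (hf : ContDiff ℝ ((⊤ : ℕ∞) : WithTop ℕ∞) f) :
    ContDiff ℝ ((⊤ : ℕ∞) : WithTop ℕ∞) (listDeriv l β f) := by
  induction l with
  | nil => exact hf
  | cons j l ih => exact pdGS_iterate_contDiff j _ ih

lemma listDeriv_pdGS {d : ℕ} (l : List (Fin d)) (β : Fin d → ℕ) (i : Fin d) {f : Ed d → ℂ}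
    (hf : ContDiff ℝ ((⊤ : ℕ∞) : WithTop ℕ∞) f) :
    listDeriv l β (pdGS i f) = pdGS i (listDeriv l β f) := by
  induction l with
  | nil => rfl
  | cons j l ih =>
    rw [listDeriv_cons, listDeriv_cons, ih, pdGS_iterate_comm i j _ (listDeriv_contDiff l β hf)]

lemma listDeriv_add_single_of_notMem {d : ℕ} (l : List (Fin d)) (β : Fin d → ℕ) (i : Fin d)
    (f : Ed d → ℂ) (hi : i ∉ l) :
    listDeriv l (β + Pi.single i 1) f = listDeriv l β f := by
  induction l with
  | nil => rfl
  | cons j l ih =>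
    have hji : j ≠ i := by rintro rfl; simp at hi
    rw [listDeriv_cons, listDeriv_cons, ih (fun h => hi (List.mem_cons_of_mem _ h))]
    simp [hji]

lemma listDeriv_add_single {d : ℕ} (l : List (Fin d)) (hl : l.Nodup) (β : Fin d → ℕ) (i : Fin d)
    {f : Ed d → ℂ} (hf : ContDiff ℝ ((⊤ : ℕ∞) : WithTop ℕ∞) f) (hi : i ∈ l) :
    listDeriv l (β + Pi.single i 1) f = listDeriv l β (pdGS i f) := by
  induction l with
  | nil => simp at hi
  | cons j l ih =>
    rw [List.nodup_cons] at hl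
    rw [listDeriv_cons, listDeriv_cons]
    by_cases hji : j = i
    · subst hji
      rw [listDeriv_add_single_of_notMem l β j f hl.1, listDeriv_pdGS l β j hf]
      simp [Function.iterate_succ_apply]
    · have : i ∈ l := by simpa [Ne.symm hji] using hi
      rw [ih hl.2 this]
      simp [hji]

lemma mderiv_pdGS {d : ℕ} (β : Fin d → ℕ) (i : Fin d) {f : Ed d → ℂ}
    (hf : ContDiff ℝ ((⊤ : ℕ∞) : WithTop ℕ∞) f) :
    mderiv β (pdGS i f) = mderiv (β + Pi.single i 1) f := by
  rw [mderiv_eq_listDeriv, mderiv_eq_listDeriv,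
    listDeriv_add_single _ (List.nodup_finRange d) β i hf (List.mem_finRange i)]

lemma mderiv_zero {d : ℕ} (f : Ed d → ℂ) : mderiv 0 f = f := by
  rw [mderiv_eq_listDeriv]
  induction List.finRange d with
  | nil => rfl
  | cons j l ih => rw [listDeriv_cons, ih]; rfl

lemma mpow_single {d : ℕ} (x : Ed d) (i : Fin d) (k : ℕ) :
    mpow x (Pi.single i k) = x i ^ k := by
  unfold mpow
  rw [Finset.prod_eq_single i (fun j _ hj => by simp [hj]) (by simp)]
  simp

lemma mfact_single {d : ℕ} (i : Fin d) (k : ℕ) :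
    mfact (Pi.single i k : Fin d → ℕ) = k.factorial := by
  unfold mfact
  rw [Finset.prod_eq_single i (fun j _ hj => by simp [hj]) (by simp)]
  simp

lemma mlen_single {d : ℕ} (i : Fin d) (k : ℕ) :
    mlen (Pi.single i k : Fin d → ℕ) = k := by
  simp [mlen]

lemma norm_le_card_mul_coord {d : ℕ} (x : Ed d) : x = 0 ∨ ∃ i, ‖x‖ ≤ d * |x i| := by
  rcases isEmpty_or_nonempty (Fin d) with h | h
  · left; ext i; exact h.elim i
  · right
    obtain ⟨i, hi⟩ := Finite.exists_max (fun i => |x i|)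
    refine ⟨i, ?_⟩
    have h1 : ‖x‖ ≤ ∑ j, |x j| := by
      conv_lhs => rw [← (EuclideanSpace.basisFun (Fin d) ℝ).sum_repr x]
      refine (norm_sum_le _ _).trans (Finset.sum_le_sum fun j _ => ?_)
      simp [norm_smul]
    refine h1.trans ((Finset.sum_le_sum fun j _ => hi j).trans ?_)
    simp

lemma exists_pow_mul_norm_le {d : ℕ} {f : Ed d → ℂ}
    (hb : ∀ α : Fin d → ℕ, ∃ C : ℝ, ∀ x, |mpow x α| * ‖f x‖ ≤ C) (k : ℕ) :
    ∃ C : ℝ, ∀ x, ‖x‖ ^ k * ‖f x‖ ≤ C := by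
  choose C hC using fun i : Fin d => hb (Pi.single i k)
  refine ⟨‖f 0‖ + ∑ i, (d : ℝ) ^ k * |C i|, fun x => ?_⟩
  have hs : ∀ i, (d : ℝ) ^ k * |C i| ≤ ∑ i, (d : ℝ) ^ k * |C i| := fun i =>
    Finset.single_le_sum (f := fun i => (d : ℝ) ^ k * |C i|)
      (fun j _ => by positivity) (Finset.mem_univ i)
  rcases norm_le_card_mul_coord x with rfl | ⟨i, hi⟩
  · have h0 : 0 ≤ ∑ i, (d : ℝ) ^ k * |C i| := Finset.sum_nonneg fun j _ => by positivity
    have h1 : ‖(0 : Ed d)‖ ^ k ≤ 1 := pow_le_one₀ (norm_nonneg _) (by simp)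
    nlinarith [norm_nonneg (f 0)]
  · have h2 := hC i x
    rw [mpow_single, abs_pow] at h2
    calc ‖x‖ ^ k * ‖f x‖ ≤ (d * |x i|) ^ k * ‖f x‖ := by gcongr
      _ = (d : ℝ) ^ k * (|x i| ^ k * ‖f x‖) := by ring
      _ ≤ (d : ℝ) ^ k * |C i| := by gcongr; exact h2.trans (le_abs_self _)
      _ ≤ _ := (hs i).trans (by linarith [norm_nonneg (f 0)])

lemma norm_iteratedFDeriv_succ_le_sum_pdGS {d : ℕ} {f : Ed d → ℂ}
    (hf : ContDiff ℝ ((⊤ : ℕ∞) : WithTop ℕ∞) f) (n : ℕ) :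
    ∃ M : Fin d → ℝ, (∀ i, 0 ≤ M i) ∧ ∀ x, ‖iteratedFDeriv ℝ (n + 1) f x‖ ≤
      ∑ i, M i * ‖iteratedFDeriv ℝ n (pdGS i f) x‖ := by
  let L (i : Fin d) : ℂ →L[ℝ] (Ed d →L[ℝ] ℂ) :=
    ContinuousLinearMap.smulRightL ℝ (Ed d) ℂ (EuclideanSpace.proj i)
  have hfd : fderiv ℝ f = fun x => ∑ i, (L i ∘ pdGS i f) x := by
    funext x
    ext v
    conv_lhs => rw [← (EuclideanSpace.basisFun (Fin d) ℝ).sum_repr v]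
    simp [L, pdGS]
  have hcd (i : Fin d) : ContDiff ℝ n (pdGS i f) :=
    (pdGS_contDiff i hf).of_le (by exact_mod_cast le_top)
  refine ⟨fun i => ‖L i‖, fun i => norm_nonneg (L i), fun x => ?_⟩
  rw [← norm_iteratedFDeriv_fderiv, hfd,
    iteratedFDeriv_fun_sum_apply fun i _ => ((L i).contDiff.comp (hcd i)).contDiffAt]
  refine (norm_sum_le _ _).trans (Finset.sum_le_sum fun i _ => ?_)
  exact (L i).norm_iteratedFDeriv_comp_left (hcd i).contDiffAt le_rfl

lemma exists_schwartz_bound {d : ℕ} (k n : ℕ) {f : Ed d → ℂ}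
    (hf : ContDiff ℝ ((⊤ : ℕ∞) : WithTop ℕ∞) f)
    (hb : ∀ α β : Fin d → ℕ, ∃ C : ℝ, ∀ x, |mpow x α| * ‖mderiv β f x‖ ≤ C) :
    ∃ C : ℝ, ∀ x, ‖x‖ ^ k * ‖iteratedFDeriv ℝ n f x‖ ≤ C := by
  induction n generalizing f with
  | zero =>
    simp only [norm_iteratedFDeriv_zero]
    exact exists_pow_mul_norm_le (fun α => by simpa only [mderiv_zero] using hb α 0) k
  | succ n ih =>
    obtain ⟨M, hM0, hM⟩ := norm_iteratedFDeriv_succ_le_sum_pdGS hf n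
    choose C hC using fun i : Fin d => ih (pdGS_contDiff i hf)
      (fun α β => by simpa only [mderiv_pdGS β i hf] using hb α (β + Pi.single i 1))
    refine ⟨∑ i, M i * C i, fun x => ?_⟩
    calc ‖x‖ ^ k * ‖iteratedFDeriv ℝ (n + 1) f x‖
        ≤ ‖x‖ ^ k * ∑ i, M i * ‖iteratedFDeriv ℝ n (pdGS i f) x‖ := by gcongr; exact hM x
      _ = ∑ i, M i * (‖x‖ ^ k * ‖iteratedFDeriv ℝ n (pdGS i f) x‖) := by
        rw [Finset.mul_sum]; exact Finset.sum_congr rfl fun i _ => by ring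
      _ ≤ _ := Finset.sum_le_sum fun i _ => mul_le_mul_of_nonneg_left (hC i x) (hM0 i)

lemma exists_bound_of_GSnorm_lt_top {d : ℕ} {s h : ℝ} (hh : 0 < h) {f : Ed d → ℂ}
    (hf : GSnorm s h f < ⊤) :
    ∃ C : ℝ, 0 ≤ C ∧ ∀ x α β, |mpow x α| * ‖mderiv β f x‖ ≤
      C * (h ^ (mlen α + mlen β) * ((mfact α : ℝ) * (mfact β : ℝ)) ^ s) := by
  refine ⟨(GSnorm s h f).toReal, ENNReal.toReal_nonneg, fun x α β => ?_⟩
  have hpos (γ : Fin d → ℕ) : (0 : ℝ) < mfact γ := by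
    exact_mod_cast Finset.prod_pos fun i _ => Nat.factorial_pos _
  have := hpos α
  have := hpos β
  rw [← div_le_iff₀ (by positivity), ← ENNReal.ofReal_le_iff_le_toReal hf.ne]
  exact le_iSup_of_le x (le_iSup_of_le α (le_iSup_of_le β le_rfl))

/-- An element of `Σ_s(ℝ^d)` as a Schwartz function. -/
def SigmaGS.toSchwartz {d : ℕ} {s : ℝ} {φ : Ed d → ℂ} (hφ : φ ∈ SigmaGS s d) :
    SchwartzMap (Ed d) ℂ where
  toFun := φ
  smooth' := hφ.1
  decay' k n := exists_schwartz_bound k n hφ.1 fun α β => by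
    obtain ⟨C, -, hC⟩ := exists_bound_of_GSnorm_lt_top one_pos (hφ.2 1 one_pos)
    exact ⟨_, fun x => hC x α β⟩

lemma hasTemperateGrowth_cexp_neg_I_mul :
    Function.HasTemperateGrowth (fun t : ℝ => Complex.exp (-(Complex.I * t))) := by
  have hder (n : ℕ) : iteratedDeriv n (fun t : ℝ => Complex.exp (-(Complex.I * t))) =
      fun t : ℝ => (-Complex.I) ^ n * Complex.exp (-(Complex.I * t)) := by
    induction n with
    | zero => simp
    | succ n ih =>
      rw [iteratedDeriv_succ, ih]
      funext t
      have h1 : HasDerivAt (fun t : ℝ => -(Complex.I * (t : ℂ))) (-(Complex.I * 1)) t :=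
        ((Complex.ofRealCLM.hasDerivAt (x := t)).const_mul Complex.I).neg
      rw [(h1.cexp.const_mul _).deriv]
      ring
  refine ⟨?_, fun n => ⟨0, 1, fun t => ?_⟩⟩
  · have : ContDiff ℝ ((⊤ : ℕ∞) : WithTop ℕ∞) (fun t : ℝ => (t : ℂ)) := Complex.ofRealCLM.contDiff
    exact (contDiff_const.mul this).neg.cexp
  · rw [norm_iteratedFDeriv_eq_norm_iteratedDeriv, hder]
    simp [Complex.norm_exp]

lemma hasTemperateGrowth_cexp_neg_I_inner {d : ℕ} (ξ : Ed d) :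
    Function.HasTemperateGrowth
      (fun y : Ed d => Complex.exp (-(Complex.I * (⟪y, ξ⟫ : ℝ)))) := by
  have h := hasTemperateGrowth_cexp_neg_I_mul.comp (innerSL ℝ ξ).hasTemperateGrowth
  convert h using 2 with y
  simp [real_inner_comm]

lemma IsSTFT.apply_dirac {d : ℕ} {s : ℝ} {u : TD d} (hu : ∀ g : SchwartzMap (Ed d) ℂ, u g = g 0)
    {φ : Ed d → ℂ} (hφ : φ ∈ SigmaGS s d) {W : Ed d × Ed d → ℂ} (hW : IsSTFT u φ W)
    (x ξ : Ed d) : W (x, ξ) = (starRingEnd ℂ) (φ (-x)) := by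
  let g₀ : SchwartzMap (Ed d) ℂ :=
    (SchwartzMap.compSubConstCLM ℝ x (SigmaGS.toSchwartz hφ)).postcompCLM
      (Complex.conjCLE : ℂ →L[ℝ] ℂ)
  let g := SchwartzMap.smulLeftCLM ℂ
    (fun y : Ed d => Complex.exp (-(Complex.I * (⟪y, ξ⟫ : ℝ)))) g₀
  have hg (y : Ed d) : g y =
      (starRingEnd ℂ) (φ (y - x)) * Complex.exp (-(Complex.I * (⟪y, ξ⟫ : ℝ))) := by
    rw [SchwartzMap.smulLeftCLM_apply_apply (hasTemperateGrowth_cexp_neg_I_inner ξ), smul_eq_mul,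
      mul_comm]
    rfl
  rw [hW x ξ g hg, hu, hg]
  simp

lemma exp_le_of_pow_le {t P C B : ℝ} (h : ∀ k : ℕ, (2 * B * t) ^ k * P ≤ C * k.factorial) :
    Real.exp (B * t) * P ≤ 2 * C := by
  have h1 := (NormedSpace.expSeries_div_hasSum_exp (B * t)).mul_right P
  have h2 := (hasSum_geometric_two).mul_left C
  rw [← Real.exp_eq_exp_ℝ] at h1
  rw [mul_comm 2 C]
  refine hasSum_le (fun k => ?_) h1 h2
  have hk : (0 : ℝ) < k.factorial := by exact_mod_cast k.factorial_pos
  rw [div_mul_eq_mul_div, div_le_iff₀ hk, one_div, inv_pow, mul_right_comm,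
    ← div_eq_mul_inv, le_div_iff₀ (by positivity)]
  have := h k
  rw [mul_assoc 2 B t, mul_pow] at this
  linarith

lemma SigmaGS.exp_coord_bound {d : ℕ} {s : ℝ} (hs : 0 < s) {φ : Ed d → ℂ} (hφ : φ ∈ SigmaGS s d)
    {B : ℝ} (hB : 0 < B) :
    ∃ C : ℝ, 0 ≤ C ∧ ∀ x i, Real.exp (B * |x i| ^ (1 / s)) * ‖φ x‖ ≤ C := by
  set b := B / s with hb
  have hbpos : 0 < b := by positivity
  have hh : 0 < (2 * b)⁻¹ ^ s := by positivity
  obtain ⟨C, hC0, hC⟩ := exists_bound_of_GSnorm_lt_top hh (hφ.2 _ hh)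
  refine ⟨(2 * C ^ (1 / s)) ^ s, by positivity, fun x i => ?_⟩
  have key : Real.exp (b * |x i| ^ (1 / s)) * ‖φ x‖ ^ (1 / s) ≤ 2 * C ^ (1 / s) := by
    refine exp_le_of_pow_le fun k => ?_
    have h1 := hC x (Pi.single i k) 0
    rw [mpow_single, mfact_single, mlen_single, mderiv_zero] at h1
    have e0 : mfact (0 : Fin d → ℕ) = 1 := by simp [mfact]
    have e1 : mlen (0 : Fin d → ℕ) = 0 := by simp [mlen]
    rw [e0, e1, abs_pow, add_zero, Nat.cast_one, mul_one] at h1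
    have h2 := Real.rpow_le_rpow (by positivity) h1 (one_div_nonneg.2 hs.le)
    have hss : s * (1 / s) = 1 := by field_simp
    rw [Real.mul_rpow (by positivity) (by positivity), Real.mul_rpow hC0 (by positivity),
      Real.mul_rpow (by positivity) (by positivity), ← Real.rpow_mul (by positivity) s, hss,
      Real.rpow_one, ← Real.rpow_natCast, ← Real.rpow_natCast, ← Real.rpow_mul (by positivity),
      ← Real.rpow_mul (by positivity), ← Real.rpow_mul (by positivity), mul_comm (k : ℝ),
      ← mul_assoc s, hss, one_mul, Real.rpow_mul (by positivity), Real.rpow_natCast, Real.rpow_natCast,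
      inv_pow] at h2
    rw [mul_pow]
    have h3 := mul_le_mul_of_nonneg_left h2 (by positivity : 0 ≤ (2 * b) ^ k)
    calc _ = (2 * b) ^ k * ((|x i| ^ (1 / s)) ^ k * ‖φ x‖ ^ (1 / s)) := by ring
      _ ≤ _ := h3
      _ = _ := by field_simp
  have h4 := Real.rpow_le_rpow (by positivity) key hs.le
  rw [Real.mul_rpow (by positivity) (by positivity), ← Real.rpow_mul (norm_nonneg _),
    one_div_mul_cancel hs.ne', Real.rpow_one, ← Real.exp_mul] at h4
  convert h4 using 3
  rw [hb]
  field_simp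

lemma SigmaGS.exp_norm_bound {d : ℕ} {s : ℝ} (hs : 0 < s) {φ : Ed d → ℂ} (hφ : φ ∈ SigmaGS s d)
    {A : ℝ} (hA : 0 < A) :
    ∃ C : ℝ, ∀ x, Real.exp (A * ‖x‖ ^ (1 / s)) * ‖φ x‖ ≤ C := by
  rcases Nat.eq_zero_or_pos d with rfl | hd
  · exact ⟨Real.exp (A * ‖(0 : Ed 0)‖ ^ (1 / s)) * ‖φ 0‖, fun x => by
      rw [Subsingleton.elim x 0]⟩
  have hd' : (0 : ℝ) < d := by exact_mod_cast hd
  have hB : 0 < A * (d : ℝ) ^ (1 / s) := by positivity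
  obtain ⟨C, -, hC⟩ := SigmaGS.exp_coord_bound hs hφ hB
  refine ⟨C, fun x => ?_⟩
  obtain ⟨i, hi⟩ : ∃ i, ‖x‖ ≤ d * |x i| := by
    rcases norm_le_card_mul_coord x with rfl | h
    · exact ⟨⟨0, hd⟩, by simp⟩
    · exact h
  refine le_trans ?_ (hC x i)
  rw [mul_assoc, ← Real.mul_rpow hd'.le (abs_nonneg _)]
  gcongr

lemma pnorm_le_mul_norm_fst {d : ℕ} {c : ℝ} {z : Ed d × Ed d} (hz : ‖z.2‖ ≤ c * ‖z.1‖) :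
    pnorm z ≤ √(1 + c ^ 2) * ‖z.1‖ := by
  unfold pnorm
  rw [← Real.sqrt_sq (norm_nonneg z.1), ← Real.sqrt_mul (by positivity),
    Real.sqrt_sq (norm_nonneg z.1)]
  have := pow_le_pow_left₀ (norm_nonneg _) hz 2
  exact Real.sqrt_le_sqrt (by nlinarith)

lemma norm_snd_le_pnorm {d : ℕ} (z : Ed d × Ed d) : ‖z.2‖ ≤ pnorm z :=
  Real.le_sqrt_of_sq_le (by nlinarith [sq_nonneg ‖z.1‖])

theorem statement8 (d : ℕ) (s : ℝ) (hs : 1/2 < s)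
    (u : TD d) (hu : ∀ g : SchwartzMap (Ed d) ℂ, u g = g 0)
    (φ : Ed d → ℂ) (hφ : φ ∈ SigmaGS s d) (hφ0 : φ ≠ 0)
    (W : Ed d × Ed d → ℂ) (hW : IsSTFT u φ W) :
    WFs s W = {z : Ed d × Ed d | z.1 = 0 ∧ z.2 ≠ 0} := by
  have hs0 : 0 < s := by linarith
  have hnorm (z : Ed d × Ed d) : ‖W z‖ = ‖φ (-z.1)‖ := by
    rw [← Prod.mk.eta (p := z), hW.apply_dirac hu hφ]
    exact RCLike.norm_conj _
  ext ⟨x₀, ξ₀⟩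
  constructor
  · rintro ⟨hz, hΓ⟩
    have hx : x₀ = 0 := by
      by_contra hx
      apply hΓ
      have hx' : 0 < ‖x₀‖ := norm_pos_iff.2 hx
      set c := (‖ξ₀‖ + 1) / ‖x₀‖ with hc
      have hc0 : 0 < c := by positivity
      refine ⟨{z | ‖z.2‖ < c * ‖z.1‖}, isOpen_lt (by fun_prop) (by fun_prop), ?_, by simp, ?_, ?_⟩
      · intro t ht z hz
        simp only [Set.mem_ofPred_eq, Prod.smul_fst, Prod.smul_snd, norm_smul, Real.norm_eq_abs,
          abs_of_pos ht] at hz ⊢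
        nlinarith
      · simp only [Set.mem_ofPred_eq, hc]
        rw [div_mul_cancel₀ _ hx'.ne']
        linarith
      · intro A hA
        have hA' : 0 < A * √(1 + c ^ 2) ^ (1 / s) := by positivity
        obtain ⟨C, hC⟩ := SigmaGS.exp_norm_bound hs0 hφ hA'
        refine ⟨C, fun z hz => le_trans ?_ (hC (-z.1))⟩
        rw [hnorm, norm_neg, mul_assoc, ← Real.mul_rpow (by positivity) (norm_nonneg _)]
        have h0 : 0 ≤ pnorm z := Real.sqrt_nonneg _
        gcongr
        exact pnorm_le_mul_norm_fst (le_of_lt hz)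
    refine ⟨hx, fun hξ => hz ?_⟩
    exact Prod.ext hx hξ
  · rintro ⟨hx, hξ⟩
    simp only at hx hξ
    subst hx
    refine ⟨fun h => hξ (congrArg Prod.snd h), ?_⟩
    rintro ⟨Γ, hopen, hconic, -, hmem, hbound⟩
    obtain ⟨C, hC⟩ := hbound 1 one_pos
    obtain ⟨x₁, hx₁⟩ : ∃ x, φ x ≠ 0 := by
      by_contra! h
      exact hφ0 (funext h)
    have hx₁' : 0 < ‖φ x₁‖ := norm_pos_iff.2 hx₁
    have hcont : Tendsto (fun t : ℝ => (t⁻¹ • (-x₁), ξ₀)) atTop (nhds ((0 : Ed d), ξ₀)) := by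
      refine Tendsto.prodMk_nhds ?_ tendsto_const_nhds
      simpa using (tendsto_inv_atTop_zero (𝕜 := ℝ)).smul_const (-x₁)
    have hev := (hcont.eventually (hopen.mem_nhds hmem)).and (eventually_gt_atTop 0)
    have hle : ∀ᶠ t : ℝ in atTop, Real.exp ((t * ‖ξ₀‖) ^ (1 / s)) * ‖φ x₁‖ ≤ C := by
      filter_upwards [hev] with t ⟨ht, htpos⟩
      have h1 := hC _ (hconic t htpos _ ht)
      rw [hnorm] at h1
      simp only [Prod.smul_mk, smul_smul, mul_inv_cancel₀ htpos.ne', one_smul, neg_neg,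
        one_mul] at h1
      refine le_trans ?_ h1
      gcongr
      simpa [norm_smul, abs_of_pos htpos] using norm_snd_le_pnorm (-x₁, t • ξ₀)
    have htop : Tendsto (fun t : ℝ => Real.exp ((t * ‖ξ₀‖) ^ (1 / s)) * ‖φ x₁‖) atTop atTop := by
      refine Tendsto.atTop_mul_const hx₁' (Real.tendsto_exp_atTop.comp ?_)
      exact (tendsto_rpow_atTop (by positivity)).comp
        (tendsto_id.atTop_mul_const (norm_pos_iff.2 hξ))
    obtain ⟨t, h1, h2⟩ := (hle.and (htop.eventually_gt_atTop C)).exists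
    linarith

end
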